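/- Let T_0 = π/(2n+1) with n ∈ ℕ. Then for every t > 0 one has μ((D(T_0,t))ᶜ) > 0; that is, the set { t > 0 : μ((D(T_0,t))ᶜ) = 0 } is empty, so the alternating observation with switch time T_0 never covers the circle up to a null set (the system is not observable in any time T). -/

import Mathlib

open MeasureTheory Set Real Filter Topology

noncomputable section

instance : Fact (0 < 2 * Real.pi) := ⟨by positivity⟩

/-- λ_k: 0 for even k, π for odd k. -/
def lam (k : ℕ) : ℝ := if Even k then 0 else Real.pi

/-- Covered set D(T₀, t) ⊆ ℝ/(2πℤ): the union over k of the projections of the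
observation intervals (k·T₀, min((k+1)·T₀, t)) translated by −λ_k. -/
def coveredSet (T0 t : ℝ) : Set (AddCircle (2 * Real.pi)) :=
  ⋃ k : ℕ, (fun a : ℝ => ((a - lam k : ℝ) : AddCircle (2 * Real.pi))) ''
    Set.Ioo ((k : ℝ) * T0) (min (((k : ℝ) + 1) * T0) t)

/-- Optimal control time T_opt(T₀). -/
def Topt (T0 : ℝ) : ℝ :=
  sInf { t : ℝ | 0 < t ∧ volume (coveredSet T0 t)ᶜ = 0 }

/-- Lemma 1.7 ii): if T₀ = π/(2n+1) then for every t > 0 the complement of the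
covered set has positive measure; the system is never observable. -/
theorem stmt_9 (n : ℕ) (T0 : ℝ) (hT0 : T0 = Real.pi / (2 * n + 1)) :
    (∀ t : ℝ, 0 < t → 0 < volume (coveredSet T0 t)ᶜ) ∧
      { t : ℝ | 0 < t ∧ volume (coveredSet T0 t)ᶜ = 0 } = ∅ := by
  have hd : (0 : ℝ) < 2 * n + 1 := by positivity
  have hT : 0 < T0 := by rw [hT0]; positivity
  have hpi : Real.pi = (2 * n + 1) * T0 := by rw [hT0]; field_simp
  have main : ∀ t : ℝ, 0 < t → 0 < volume (coveredSet T0 t)ᶜ := by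
    intro t _
    have hopen : IsOpen ((fun x : ℝ => (x : AddCircle (2 * Real.pi))) '' Ioo T0 (2 * T0)) :=
      QuotientAddGroup.isOpenMap_coe _ isOpen_Ioo
    have hne : ((fun x : ℝ => (x : AddCircle (2 * Real.pi))) '' Ioo T0 (2 * T0)).Nonempty :=
      (nonempty_Ioo.2 (by linarith)).image _
    refine lt_of_lt_of_le (hopen.measure_pos volume hne) (measure_mono ?_)
    rintro _ ⟨x, ⟨hx1, hx2⟩, rfl⟩ hmem
    simp only [coveredSet, mem_iUnion, mem_image] at hmem
    obtain ⟨k, a, ⟨ha1, ha2⟩, hax⟩ := hmem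
    have ha3 := lt_of_lt_of_le ha2 (min_le_left _ _)
    have h0 : ((a - lam k - x : ℝ) : AddCircle (2 * Real.pi)) = 0 := by
      rw [AddCircle.coe_sub, hax, sub_self]
    obtain ⟨m, hm⟩ := (AddCircle.coe_eq_zero_iff _).1 h0
    rw [zsmul_eq_mul] at hm
    obtain ⟨c, hc, hpar⟩ : ∃ c : ℤ, lam k = c * T0 ∧ Even ((k : ℤ) - c) := by
      by_cases hk : Even k
      · exact ⟨0, by simp [lam, hk], by simpa using hk⟩
      · refine ⟨2 * n + 1, by simp [lam, hk]; exact hpi, ?_⟩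
        rw [Nat.not_even_iff_odd] at hk
        obtain ⟨j, hj⟩ := hk
        exact ⟨j - n, by subst hj; push_cast; ring⟩
    obtain ⟨j, hj⟩ := hpar
    have hjr : (k : ℝ) = c + j + j := by
      have : (k : ℤ) = c + j + j := by linarith
      exact_mod_cast this
    have ha : a = x + (c + m * (2 * (2 * n + 1))) * T0 := by
      rw [hc, hpi] at hm
      linarith
    set q : ℤ := j - m * (2 * n + 1) with hq
    have hqr : (q : ℝ) = j - m * (2 * n + 1) := by rw [hq]; push_cast; ring
    have e1 : (2 * (q : ℝ)) * T0 < 2 * T0 := by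
      rw [hqr]; rw [hjr, ha] at ha1; linarith
    have e2 : 1 * T0 < (2 * (q : ℝ) + 1) * T0 := by
      rw [hqr]; rw [hjr, ha] at ha3; linarith
    have f1 := lt_of_mul_lt_mul_right e1 hT.le
    have f2 := lt_of_mul_lt_mul_right e2 hT.le
    have g1 : 2 * q < 2 := by exact_mod_cast f1
    have g2 : 1 < 2 * q + 1 := by exact_mod_cast f2
    omega
  refine ⟨main, ?_⟩
  ext t
  simp only [mem_setOf_eq, mem_empty_iff_false, iff_false, not_and]
  exact fun ht => (main t ht).ne'
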